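/- First moment formula for the first coordinate of the affine semigroup. Assume a₁ > 0 and γ := a₂ + ∫_G z₁ n(dz) < ∞. Then for every t ≥ 0 and every x = (x₁,x₂) ∈ G, the first coordinate is integrable under P_t(x,·) and ∫_G ξ₁ P_t(x,dξ) = x₁ e^{−a₁ t} + (γ/a₁)(1 − e^{−a₁ t}). In particular, for x = (x₁,x₂) and y = (y₁,y₂), ∫_G ξ₁ P_t(x,dξ) − ∫_G ξ₁ P_t(y,dξ) = (x₁ − y₁) e^{−a₁ t}. -/

import Mathlib

open MeasureTheory Filter Set Topology
open scoped ENNReal Classical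

noncomputable section

namespace AffinePaper

/-- Total variation distance between two measures:
`‖μ - ν‖_var = sup {|∫ f dμ - ∫ f dν| : f measurable, |f| ≤ 1}`. -/
def tvDist {α : Type*} [MeasurableSpace α] (μ ν : Measure α) : ℝ :=
  ⨆ f : {f : α → ℝ // Measurable f ∧ ∀ x, |f x| ≤ 1},
    |(∫ x, f.1 x ∂μ) - ∫ x, f.1 x ∂ν|

/-- Translate of a measure on `ℝ` by `a`, i.e. `δ_a * σ`. -/
def translate (a : ℝ) (σ : Measure ℝ) : Measure ℝ := Measure.map (fun x => x + a) σ

/-- The function `φ` of the affine process. -/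
def phi (a₁ b₁ α₁₁ α₁₂ α₂₁ α₂₂ : ℝ) (m : Measure (ℝ × ℝ)) (u : ℂ × ℂ) : ℂ :=
  -(a₁ : ℂ) * u.1 - (b₁ : ℂ) * u.2 + ((α₁₁ : ℂ) + (α₁₂ : ℂ)) * u.1 ^ 2
    + 2 * ((Real.sqrt (α₁₁ * α₂₁) : ℂ) + (Real.sqrt (α₁₂ * α₂₂) : ℂ)) * u.1 * u.2
    + ((α₂₁ : ℂ) + (α₂₂ : ℂ)) * u.2 ^ 2
    + ∫ z : ℝ × ℝ,
        (Complex.exp (u.1 * (z.1 : ℂ) + u.2 * (z.2 : ℂ)) - 1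
          - (u.1 * (z.1 : ℂ) + u.2 * (z.2 : ℂ))) ∂m

/-- The function `ψ` of the affine process. -/
def psi (a₂ b₀ σ : ℝ) (n : Measure (ℝ × ℝ)) (u : ℂ × ℂ) : ℂ :=
  (a₂ : ℂ) * u.1 - (b₀ : ℂ) * u.2 + (σ : ℂ) ^ 2 / 2 * u.2 ^ 2
    + ∫ z : ℝ × ℝ,
        (Complex.exp (u.1 * (z.1 : ℂ) + u.2 * (z.2 : ℂ)) - 1 - (z.2 : ℂ) * u.2) ∂n

/-- The branching mechanism `φ₀`. -/
def phi0 (a₁ α₁₁ α₁₂ : ℝ) (m : Measure (ℝ × ℝ)) (x : ℝ) : ℝ :=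
  a₁ * x + (α₁₁ + α₁₂) * x ^ 2 + ∫ z : ℝ × ℝ, (Real.exp (-x * z.1) - 1 + x * z.1) ∂m

/-- Condition (A): Grey's condition. -/
def CondA (a₁ α₁₁ α₁₂ : ℝ) (m : Measure (ℝ × ℝ)) : Prop :=
  ∃ θ > (0 : ℝ), (∀ z ≥ θ, 0 < phi0 a₁ α₁₁ α₁₂ m z) ∧
    ∫⁻ z in Set.Ici θ, ENNReal.ofReal (phi0 a₁ α₁₁ α₁₂ m z)⁻¹ < ⊤

/-- The measure `n_ε` on `ℝ`. -/
def nEps (n : Measure (ℝ × ℝ)) (ε : ℝ) : Measure ℝ :=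
  if n {z : ℝ × ℝ | 0 ≤ z.1} < ⊤ then
    Measure.map Prod.snd (n.restrict {z : ℝ × ℝ | 0 ≤ z.1})
  else
    Measure.map Prod.snd (n.restrict {z : ℝ × ℝ | 0 ≤ z.1 ∧ ε ≤ |z.2|})

/-- Condition (B), with the constants `ε, η` explicit. -/
def CondB (n : Measure (ℝ × ℝ)) (ε η : ℝ) : Prop :=
  0 < ε ∧ 0 < η ∧
  (∃ c : ℝ≥0∞, 0 < c ∧
      ∀ a : ℝ, |a| ≤ η → c ≤ (nEps n ε ⊓ translate a (nEps n ε)) Set.univ) ∧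
  ∫⁻ z in {z : ℝ × ℝ | ε < |z.2|}, ENNReal.ofReal |z.2| ∂n < ⊤

/-- `limsup_{ρ → 0} [ sup_{|a| ≤ ρ} ‖σ - δ_a * σ‖_var / ρ ] < ∞`. -/
def SmoothShift (σ : Measure ℝ) : Prop :=
  ∃ C > (0 : ℝ), ∃ δ > (0 : ℝ), ∀ ρ : ℝ, 0 < ρ → ρ ≤ δ →
    ∀ a : ℝ, |a| ≤ ρ → tvDist σ (translate a σ) ≤ C * ρ

/-- Condition (C), with the constant `ε` explicit. -/
def CondC (n : Measure (ℝ × ℝ)) (ε : ℝ) : Prop :=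
  0 < ε ∧ 0 < nEps n ε Set.univ ∧ SmoothShift (nEps n ε) ∧
  ∫⁻ z in {z : ℝ × ℝ | ε < |z.2|}, ENNReal.ofReal |z.2| ∂n < ⊤

/-- Condition (C'), with the constant `ε` explicit. -/
def CondC' (n : Measure (ℝ × ℝ)) (ε : ℝ) : Prop :=
  0 < ε ∧ 0 < nEps n ε Set.univ ∧ SmoothShift (nEps n ε) ∧
  ∫⁻ z in {z : ℝ × ℝ | 1 < |z.2|}, ENNReal.ofReal (z.2 ^ 2) ∂n < ⊤

/-- The measure `σ₀ = ϱ₀(z₂) dz₂` of Condition (D). -/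
def sigma0 (ϱ₀ : ℝ → ℝ) : Measure ℝ :=
  volume.withDensity fun x => ENNReal.ofReal (ϱ₀ x)

/-- The measure `σ_k = ((k g) ∧ ϱ₀)(z₂) dz₂` of Condition (D). -/
def sigmaK (ϱ₀ g : ℝ → ℝ) (k : ℕ) : Measure ℝ :=
  volume.withDensity fun x => ENNReal.ofReal (min ((k : ℝ) * g x) (ϱ₀ x))

/-- Condition (D), with `ϱ₀`, `g` and `K` explicit. -/
def CondD (n : Measure (ℝ × ℝ)) (ϱ₀ g : ℝ → ℝ) (K : ℕ) : Prop :=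
  Measurable ϱ₀ ∧ (∀ x, 0 ≤ ϱ₀ x) ∧
  (∀ B : Set ℝ, MeasurableSet B → sigma0 ϱ₀ B ≤ n {z : ℝ × ℝ | 0 ≤ z.1 ∧ z.2 ∈ B}) ∧
  0 < sigma0 ϱ₀ Set.univ ∧
  (∀ x, 0 < g x) ∧ Integrable g ∧ 1 ≤ K ∧
  ∀ k, K ≤ k → SmoothShift (sigmaK ϱ₀ g k) ∧
    ∫⁻ x, ENNReal.ofReal |x| ∂(sigmaK ϱ₀ g k) < ⊤

/-- The transition semigroup of a (1+1)-dimensional affine Markov process, together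
with all the standing assumptions of the paper. -/
structure AffineSemigroup where
  a₁ : ℝ
  a₂ : ℝ
  b₀ : ℝ
  b₁ : ℝ
  b₂ : ℝ
  σ : ℝ
  α₁₁ : ℝ
  α₁₂ : ℝ
  α₂₁ : ℝ
  α₂₂ : ℝ
  m : Measure (ℝ × ℝ)
  n : Measure (ℝ × ℝ)
  V₁ : ℝ → ℂ × ℂ → ℂ
  P : ℝ → ℝ × ℝ → Measure (ℝ × ℝ)
  a₂_nonneg : 0 ≤ a₂
  σ_nonneg : 0 ≤ σ
  α₁₁_nonneg : 0 ≤ α₁₁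
  α₁₂_nonneg : 0 ≤ α₁₂
  α₂₁_nonneg : 0 ≤ α₂₁
  α₂₂_nonneg : 0 ≤ α₂₂
  m_supp : m {z : ℝ × ℝ | z.1 < 0 ∨ z = 0} = 0
  n_supp : n {z : ℝ × ℝ | z.1 < 0 ∨ z = 0} = 0
  m_int : ∫⁻ z : ℝ × ℝ, ENNReal.ofReal (min z.1 (z.1 ^ 2) + z.2 ^ 2) ∂m < ⊤
  n_int : ∫⁻ z : ℝ × ℝ, ENNReal.ofReal (min 1 z.1 + min |z.2| (z.2 ^ 2)) ∂n < ⊤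
  V₁_init : ∀ u : ℂ × ℂ, V₁ 0 u = u.1
  V₁_mem : ∀ u : ℂ × ℂ, u.1.re ≤ 0 → u.2.re = 0 → ∀ t, 0 ≤ t → (V₁ t u).re ≤ 0
  V₁_ode : ∀ u : ℂ × ℂ, u.1.re ≤ 0 → u.2.re = 0 → ∀ t, 0 ≤ t →
    HasDerivAt (fun s => V₁ s u)
      (phi a₁ b₁ α₁₁ α₁₂ α₂₁ α₂₂ m
        (V₁ t u, Complex.exp (-(b₂ : ℂ) * (t : ℂ)) * u.2)) t
  P_prob : ∀ t, 0 ≤ t → ∀ x : ℝ × ℝ, 0 ≤ x.1 → IsProbabilityMeasure (P t x)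
  P_supp : ∀ t, 0 ≤ t → ∀ x : ℝ × ℝ, 0 ≤ x.1 → P t x {ξ : ℝ × ℝ | ξ.1 < 0} = 0
  P_meas : ∀ t, 0 ≤ t → Measurable (P t)
  P_zero : ∀ x : ℝ × ℝ, P 0 x = Measure.dirac x
  P_CK : ∀ t, 0 ≤ t → ∀ s, 0 ≤ s → ∀ x : ℝ × ℝ, P (t + s) x = (P t x).bind (P s)
  P_char : ∀ t, 0 ≤ t → ∀ x : ℝ × ℝ, 0 ≤ x.1 → ∀ u : ℂ × ℂ, u.1.re = 0 → u.2.re = 0 →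
    ∫ ξ : ℝ × ℝ, Complex.exp (u.1 * (ξ.1 : ℂ) + u.2 * (ξ.2 : ℂ)) ∂(P t x)
      = Complex.exp ((x.1 : ℂ) * V₁ t u
          + (x.2 : ℂ) * (Complex.exp (-(b₂ : ℂ) * (t : ℂ)) * u.2)
          + ∫ s in (0:ℝ)..t,
              psi a₂ b₀ σ n (V₁ s u, Complex.exp (-(b₂ : ℂ) * (s : ℂ)) * u.2))

/-- A stationary (invariant) distribution for the semigroup `P` on `G = ℝ₊ × ℝ`. -/
def IsStationary (P : ℝ → ℝ × ℝ → Measure (ℝ × ℝ)) (π : Measure (ℝ × ℝ)) : Prop :=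
  IsProbabilityMeasure π ∧ π {x : ℝ × ℝ | x.1 < 0} = 0 ∧ ∀ t, 0 ≤ t → π.bind (P t) = π

/-- Defining properties of the minimal solution `v̄` of `(d/dt) v̄_t = -φ₀(v̄_t)`,
`v̄_{0+} = ∞`. -/
def IsVbar (a₁ α₁₁ α₁₂ : ℝ) (m : Measure (ℝ × ℝ)) (v : ℝ → ℝ) : Prop :=
  (∀ t > (0 : ℝ), 0 < v t) ∧
  (∀ t > (0 : ℝ), HasDerivAt v (-(phi0 a₁ α₁₁ α₁₂ m (v t))) t) ∧
  Tendsto v (𝓝[>] (0 : ℝ)) atTop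

theorem one_sub_cos_div_eq_integral_sin {θ : ℝ} (hθ : θ ≠ 0) (x : ℝ) :
    ∫ u in (0 : ℝ)..1, Real.sin (θ * u * x) = (1 - Real.cos (θ * x)) / (θ * x) := by
  rcases eq_or_ne x 0 with rfl | hx
  · simp
  · have h : ∀ u : ℝ, Real.sin (θ * u * x) = Real.sin ((θ * x) * u) := fun u => by ring_nf
    simp_rw [h]
    rw [intervalIntegral.integral_comp_mul_left (fun y => Real.sin y) (mul_ne_zero hθ hx)]
    simp [div_eq_inv_mul]

/-- A nonnegative random variable whose characteristic function is Lipschitz at the origin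
is integrable. -/
theorem integrable_of_norm_integral_exp_sub_one_le {Ω : Type*} [MeasurableSpace Ω]
    {μ : Measure Ω} [IsProbabilityMeasure μ] {X : Ω → ℝ} (hX : Measurable X)
    (hX0 : ∀ᵐ ω ∂μ, 0 ≤ X ω) {C : ℝ}
    (hC : ∀ᶠ θ : ℝ in 𝓝 0, ‖(∫ ω, Complex.exp (θ * Complex.I * X ω) ∂μ) - 1‖ ≤ C * |θ|) :
    Integrable X μ := by
  obtain ⟨δ, hδ, hC⟩ := Metric.eventually_nhds_iff.1 hC
  have hsin : ∀ θ : ℝ, |θ| < δ → |∫ ω, Real.sin (θ * X ω) ∂μ| ≤ C * |θ| := by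
    intro θ hθ
    have hint : Integrable (fun ω => Complex.exp (θ * Complex.I * X ω)) μ := by
      refine Integrable.of_bound (by fun_prop) 1 (Eventually.of_forall fun ω => ?_)
      rw [Complex.norm_exp]
      simp
    have him : ∫ ω, Real.sin (θ * X ω) ∂μ
        = ((∫ ω, Complex.exp (θ * Complex.I * X ω) ∂μ) - 1).im := by
      have := integral_im hint
      simp only [RCLike.im_to_complex] at this
      rw [Complex.sub_im, ← this]
      simp only [Complex.one_im, sub_zero]
      refine integral_congr_ae (Eventually.of_forall fun ω => ?_)
      simp [Complex.exp_im]
    rw [him]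
    exact (Complex.abs_im_le_norm _).trans (hC (by simpa using hθ))
  set G : ℝ → Ω → ℝ := fun θ ω => (1 - Real.cos (θ * X ω)) / (θ * X ω) / θ with hG
  have hGm : ∀ θ, Measurable (G θ) := fun θ => by simp only [hG]; fun_prop
  have hGint : ∀ θ, 0 < θ → θ < δ →
      ∫⁻ ω, ENNReal.ofReal (G θ ω) ∂μ ≤ ENNReal.ofReal C := by
    intro θ hθ hθδ
    have : IsFiniteMeasure (volume.restrict (Set.uIoc (0 : ℝ) 1)) := by
      rw [Set.uIoc_of_le zero_le_one]; infer_instance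
    have hunc : Integrable (Function.uncurry fun (u : ℝ) ω => Real.sin (θ * u * X ω))
        ((volume.restrict (Set.uIoc 0 1)).prod μ) := by
      refine Integrable.of_bound (C := 1) ?_ (Eventually.of_forall fun p => ?_)
      · refine Measurable.aestronglyMeasurable ?_
        simp only [Function.uncurry_def]
        fun_prop
      · simpa [Function.uncurry_def] using Real.abs_sin_le_one _
    have hswap := intervalIntegral_integral_swap hunc
    simp_rw [one_sub_cos_div_eq_integral_sin hθ.ne'] at hswap
    have hGi : Integrable (G θ) μ := by
      refine Integrable.div_const ?_ θ
      simp_rw [← one_sub_cos_div_eq_integral_sin hθ.ne']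
      refine Integrable.of_bound (C := 1) ?_ (Eventually.of_forall fun ω => ?_)
      · simp_rw [one_sub_cos_div_eq_integral_sin hθ.ne']
        exact Measurable.aestronglyMeasurable (by fun_prop)
      · refine (intervalIntegral.norm_integral_le_of_norm_le_const (C := 1)
          fun u _ => ?_).trans (by simp)
        simpa using Real.abs_sin_le_one _
    rw [← ofReal_integral_eq_lintegral_ofReal hGi]
    · refine ENNReal.ofReal_le_ofReal ?_
      simp only [hG]
      rw [integral_div, ← hswap, div_le_iff₀ hθ]
      refine (Real.le_norm_self _).trans ?_
      refine (intervalIntegral.norm_integral_le_of_norm_le_const (C := C * θ)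
          fun u hu => ?_).trans_eq (by simp)
      rw [Set.uIoc_of_le zero_le_one] at hu
      have h1 : |θ * u| ≤ θ := by
        rw [abs_of_nonneg (mul_nonneg hθ.le hu.1.le)]
        nlinarith [hu.2]
      have h0 : 0 < |θ * u| := abs_pos.2 (mul_pos hθ hu.1).ne'
      have h2 := hsin (θ * u) (h1.trans_lt hθδ)
      have hC0 : 0 ≤ C := nonneg_of_mul_nonneg_left ((abs_nonneg _).trans h2) h0
      exact h2.trans (mul_le_mul_of_nonneg_left h1 hC0)
    · filter_upwards [hX0] with ω hω
      have := Real.cos_le_one (θ * X ω)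
      exact div_nonneg (div_nonneg (by linarith) (mul_nonneg hθ.le hω)) hθ.le
  set θ : ℕ → ℝ := fun n => 1 / ((n : ℝ) + 1) with hθdef
  have hθ0 : ∀ n, 0 < θ n := fun n => by simp only [hθdef]; positivity
  have hθlim : Tendsto θ atTop (𝓝 0) := tendsto_one_div_add_atTop_nhds_zero_nat
  have hfatou := lintegral_liminf_le (μ := μ) (u := atTop)
    (f := fun n ω => ENNReal.ofReal (G (θ n) ω)) fun n => (hGm _).ennreal_ofReal
  have hle : liminf (fun n => ∫⁻ ω, ENNReal.ofReal (G (θ n) ω) ∂μ) atTop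
      ≤ ENNReal.ofReal C := by
    refine liminf_le_of_frequently_le' (Eventually.frequently ?_)
    filter_upwards [hθlim.eventually (gt_mem_nhds hδ)] with n hn
    exact hGint _ (hθ0 n) hn
  have hlow : ∫⁻ ω, ENNReal.ofReal (2 / Real.pi ^ 2 * X ω) ∂μ
      ≤ ∫⁻ ω, liminf (fun n => ENNReal.ofReal (G (θ n) ω)) atTop ∂μ := by
    refine lintegral_mono_ae ?_
    filter_upwards [hX0] with ω hω
    have hlim : Tendsto (fun n => θ n * X ω) atTop (𝓝 0) := by
      simpa using hθlim.mul_const (X ω)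
    refine le_liminf_of_le (by isBoundedDefault) ?_
    filter_upwards [hlim.eventually (gt_mem_nhds Real.pi_pos)] with n hn
    refine ENNReal.ofReal_le_ofReal ?_
    rcases hω.eq_or_lt with h0 | hpos
    · simp [hG, ← h0]
    · have hy : 0 < θ n * X ω := mul_pos (hθ0 n) hpos
      have hcos := Real.cos_le_one_sub_mul_cos_sq (x := θ n * X ω)
        (by rw [abs_of_pos hy]; exact hn.le)
      simp only [hG]
      rw [le_div_iff₀ (hθ0 n), le_div_iff₀ hy]
      calc 2 / Real.pi ^ 2 * X ω * θ n * (θ n * X ω)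
          = 2 / Real.pi ^ 2 * (θ n * X ω) ^ 2 := by ring
        _ ≤ _ := by linarith
  have hfin : ∫⁻ ω, ENNReal.ofReal (2 / Real.pi ^ 2 * X ω) ∂μ < ⊤ :=
    (hlow.trans (hfatou.trans hle)).trans_lt ENNReal.ofReal_lt_top
  have hπ : (0 : ℝ) < 2 / Real.pi ^ 2 := by have := Real.pi_pos; positivity
  have hi : Integrable (fun ω => 2 / Real.pi ^ 2 * X ω) μ := by
    refine (lintegral_ofReal_ne_top_iff_integrable (by fun_prop) ?_).1 hfin.ne
    filter_upwards [hX0] with ω hω using mul_nonneg hπ.le hω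
  refine (hi.const_mul (2 / Real.pi ^ 2)⁻¹).congr (Eventually.of_forall fun ω => ?_)
  exact inv_mul_cancel_left₀ hπ.ne' _

/-- For a nonnegative random variable, differentiability of the characteristic function at the
origin implies integrability and identifies the mean. -/
theorem integrable_and_integral_eq_of_hasDerivAt_integral_exp {Ω : Type*} [MeasurableSpace Ω]
    {μ : Measure Ω} [IsProbabilityMeasure μ] {X : Ω → ℝ} (hX : Measurable X)
    (hX0 : ∀ᵐ ω ∂μ, 0 ≤ X ω) {M : ℝ}
    (hM : HasDerivAt (fun θ : ℝ => ∫ ω, Complex.exp (θ * Complex.I * X ω) ∂μ)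
      (M * Complex.I) 0) :
    Integrable X μ ∧ ∫ ω, X ω ∂μ = M := by
  have hint : Integrable X μ := by
    obtain ⟨C, hC⟩ := hM.isBigO_sub.bound
    refine integrable_of_norm_integral_exp_sub_one_le hX hX0 (C := C) ?_
    simpa using hC
  refine ⟨hint, ?_⟩
  have h := (hasDerivAt_integral_of_dominated_loc_of_deriv_le (μ := μ) (𝕜 := ℝ) (s := Set.univ)
    (x₀ := 0) (F := fun (θ : ℝ) ω => Complex.exp (θ * Complex.I * X ω))
    (F' := fun (θ : ℝ) ω => Complex.exp (θ * Complex.I * X ω) * (Complex.I * X ω))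
    (bound := fun ω => |X ω|) Filter.univ_mem
    (Eventually.of_forall fun θ => by fun_prop) (by simp) (by fun_prop)
    (Eventually.of_forall fun ω θ _ => by simp [Complex.norm_exp]) hint.abs
    (Eventually.of_forall fun ω θ _ => by
      have h1 : HasDerivAt (fun θ : ℝ => (θ : ℂ) * Complex.I * X ω) (Complex.I * X ω) θ := by
        simpa using ((Complex.ofRealCLM.hasDerivAt (x := θ)).mul_const Complex.I).mul_const
          (X ω : ℂ)
      exact h1.cexp)).2
  have heq := h.unique hM
  simp only [Complex.ofReal_zero, zero_mul, Complex.exp_zero, one_mul, integral_const_mul,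
    integral_complex_ofReal] at heq
  rw [mul_comm] at heq
  exact_mod_cast mul_right_cancel₀ Complex.I_ne_zero heq

theorem norm_exp_sub_one_sub_id_le_min_of_re_nonpos {w : ℂ} (hw : w.re ≤ 0) :
    ‖Complex.exp w - 1 - w‖ ≤ 3 * min ‖w‖ (‖w‖ ^ 2) := by
  have h0 := norm_nonneg w
  rcases le_total ‖w‖ 1 with h | h
  · have h1 := Complex.norm_exp_sub_one_sub_id_le h
    rw [min_eq_right (by nlinarith)]
    nlinarith
  · have h1 : ‖Complex.exp w‖ ≤ 1 := by
      rw [Complex.norm_exp]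
      exact Real.exp_le_one_iff.2 hw
    have h2 := norm_sub_le (Complex.exp w - 1) w
    have h3 := norm_sub_le (Complex.exp w) 1
    rw [norm_one] at h3
    rw [min_eq_left (by nlinarith)]
    linarith

theorem norm_exp_sub_one_le_of_re_nonpos {w : ℂ} (hw : w.re ≤ 0) :
    ‖Complex.exp w - 1‖ ≤ 4 * ‖w‖ := by
  have h1 := norm_exp_sub_one_sub_id_le_min_of_re_nonpos hw
  have h2 := min_le_left ‖w‖ (‖w‖ ^ 2)
  have h3 := norm_add_le (Complex.exp w - 1 - w) w
  rw [sub_add_cancel] at h3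
  linarith

theorem mul_ofReal_re_nonpos {v : ℂ} (hv : v.re ≤ 0) {x : ℝ} (hx : 0 ≤ x) :
    (v * (x : ℂ)).re ≤ 0 := by
  rw [Complex.re_mul_ofReal]
  exact mul_nonpos_of_nonpos_of_nonneg hv hx

theorem isLittleO_integral_exp_sub_one_sub_id {Ω : Type*} [MeasurableSpace Ω]
    {μ : Measure Ω} {X : Ω → ℝ} (hX : Measurable X) (hX0 : ∀ᵐ ω ∂μ, 0 ≤ X ω)
    (hint : Integrable (fun ω => min (X ω) (X ω ^ 2)) μ) :
    (fun v : ℂ => ∫ ω, (Complex.exp (v * X ω) - 1 - v * X ω) ∂μ)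
      =o[𝓝[{v : ℂ | v.re ≤ 0}] 0] fun v => v := by
  have key : ∀ v : ℂ, v.re ≤ 0 → ∀ x : ℝ, 0 ≤ x →
      ‖Complex.exp (v * x) - 1 - v * x‖ / ‖v‖ ≤ 3 * min x (‖v‖ * x ^ 2) := by
    intro v hv x hx
    have h := norm_exp_sub_one_sub_id_le_min_of_re_nonpos (mul_ofReal_re_nonpos hv hx)
    have hn : ‖v * (x : ℂ)‖ = ‖v‖ * x := by simp [abs_of_nonneg hx]
    rw [hn] at h
    have hv0 := norm_nonneg v
    refine div_le_of_le_mul₀ hv0 (by positivity) (h.trans_eq ?_)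
    rw [mul_assoc, min_mul_of_nonneg _ _ hv0]
    ring_nf
  have hlim : Tendsto (fun v : ℂ => ∫ ω, ‖Complex.exp (v * X ω) - 1 - v * X ω‖ / ‖v‖ ∂μ)
      (𝓝[{v : ℂ | v.re ≤ 0}] 0) (𝓝 (∫ _, (0 : ℝ) ∂μ)) := by
    refine tendsto_integral_filter_of_dominated_convergence
      (fun ω => 3 * min (X ω) (X ω ^ 2)) (Eventually.of_forall fun v => ?_) ?_
      (hint.const_mul 3) ?_
    · exact Measurable.aestronglyMeasurable (by fun_prop)
    · have h1 : ∀ᶠ v : ℂ in 𝓝[{v : ℂ | v.re ≤ 0}] 0, ‖v‖ < 1 := by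
        refine nhdsWithin_le_nhds ?_
        filter_upwards [Metric.ball_mem_nhds (0 : ℂ) one_pos] with v hv
        simpa using hv
      filter_upwards [h1, self_mem_nhdsWithin] with v hv hre
      filter_upwards [hX0] with ω hω
      rw [norm_div, norm_norm, norm_norm]
      refine (key v hre _ hω).trans ?_
      gcongr
      exact mul_le_of_le_one_left (sq_nonneg _) hv.le
    · filter_upwards [hX0] with ω hω
      have hz : Tendsto (fun v : ℂ => 3 * (‖v‖ * X ω ^ 2)) (𝓝[{v : ℂ | v.re ≤ 0}] 0) (𝓝 0) := by
        refine Tendsto.mono_left ?_ nhdsWithin_le_nhds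
        have : Continuous fun v : ℂ => 3 * (‖v‖ * X ω ^ 2) := by fun_prop
        simpa using this.tendsto 0
      refine squeeze_zero' (Eventually.of_forall fun v => by positivity) ?_ hz
      filter_upwards [self_mem_nhdsWithin] with v hre
      exact (key v hre _ hω).trans (by gcongr; exact min_le_right _ _)
  rw [integral_zero] at hlim
  refine Asymptotics.isLittleO_iff.2 fun c hc => ?_
  filter_upwards [hlim.eventually (gt_mem_nhds hc)] with v hv
  rcases eq_or_ne v 0 with rfl | hv0
  · simp
  · rw [integral_div, div_lt_iff₀ (norm_pos_iff.2 hv0)] at hv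
    exact (norm_integral_le_integral_norm _).trans hv.le

/-- Solutions of `v' = f v` staying in a closed set `D`, where `f v = -a v + o(v)` at `0`
within `D`, are on compact time intervals asymptotic to the linear flow for small initial
values. -/
theorem exists_norm_sub_exp_mul_le_of_isLittleO {f : ℂ → ℂ} {D : Set ℂ} {a t κ : ℝ}
    (ha : 0 ≤ a) (ht : 0 ≤ t) (hκ : 0 < κ)
    (hf : (fun v => f v + a * v) =o[𝓝[D] 0] fun v => v) :
    ∃ δ > 0, ∀ v : ℝ → ℂ, (∀ s ∈ Icc 0 t, v s ∈ D) →
      (∀ s ∈ Icc 0 t, HasDerivAt v (f (v s)) s) → ‖v 0‖ < δ →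
      ∀ s ∈ Icc 0 t, ‖v s - Complex.exp (-a * s) * v 0‖ ≤ κ * ‖v 0‖ := by
  set η : ℝ := κ / (2 * (t + 1) * Real.exp (a * t) * (1 + κ)) with hη
  have hη0 : 0 < η := by positivity
  obtain ⟨r, hr, hfr⟩ := Metric.eventually_nhds_iff.1
    (eventually_nhdsWithin_iff.1 (hf.bound hη0))
  refine ⟨r / (1 + κ), by positivity, fun v hvD hv hv0 s hs => ?_⟩
  have hexp : ∀ s : ℝ, ‖Complex.exp (a * s)‖ = Real.exp (a * s) := fun s => by
    rw [← Complex.ofReal_mul, ← Complex.ofReal_exp, Complex.norm_real, Real.norm_eq_abs,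
      Real.abs_exp]
  have hmain : ∀ ε, ‖v 0‖ < ε → ε < r / (1 + κ) →
      ‖Complex.exp (a * s) * v s - v 0‖ ≤ κ * ε := by
    intro ε hε hεr
    have hε0 : 0 < ε := (norm_nonneg _).trans_lt hε
    have hderiv : ∀ s ∈ Icc 0 t, HasDerivAt (fun s : ℝ => Complex.exp (a * s) * v s - v 0)
        (Complex.exp (a * s) * (f (v s) + a * v s)) s := by
      intro s hs
      have h1 : HasDerivAt (fun s : ℝ => (a : ℂ) * s) a s := by
        simpa using (Complex.ofRealCLM.hasDerivAt (x := s)).const_mul (a : ℂ)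
      refine ((h1.cexp.mul (hv s hs)).sub_const (v 0)).congr_deriv ?_
      ring
    have hB : ∀ s : ℝ, HasDerivAt (fun s : ℝ => κ * ε / (t + 1) * (s + 1))
        (κ * ε / (t + 1)) s := fun s => by
      simpa using ((hasDerivAt_id s).add_const (1 : ℝ)).const_mul (κ * ε / (t + 1))
    have hBle : ∀ s ≤ t, κ * ε / (t + 1) * (s + 1) ≤ κ * ε := by
      intro s hs
      rw [div_mul_eq_mul_div]
      exact div_le_of_le_mul₀ (by linarith) (by positivity) (by gcongr)
    refine le_trans (image_norm_le_of_norm_deriv_right_lt_deriv_boundary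
      (fun s hs => (hderiv s hs).continuousAt.continuousWithinAt)
      (fun s hs => (hderiv s (Ico_subset_Icc_self hs)).hasDerivWithinAt) ?_ hB ?_ hs)
      (hBle s hs.2)
    · simp only [Complex.ofReal_zero, mul_zero, Complex.exp_zero, one_mul, sub_self, norm_zero]
      positivity
    · intro s hs heq
      have h1 : 1 ≤ Real.exp (a * s) := Real.one_le_exp (mul_nonneg ha hs.1)
      have h2 : ‖Complex.exp (a * s) * v s‖ ≤ (1 + κ) * ε := by
        have h3 := norm_add_le (Complex.exp (a * s) * v s - v 0) (v 0)
        rw [sub_add_cancel, heq] at h3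
        have := hBle s hs.2.le
        linarith
      have h4 : ‖v s‖ ≤ (1 + κ) * ε := by
        rw [norm_mul, hexp] at h2
        exact (le_mul_of_one_le_left (norm_nonneg _) h1).trans h2
      have h5 : ‖v s‖ < r := by
        rw [lt_div_iff₀ (by positivity)] at hεr
        linarith
      have h6 := hfr (by simpa using h5) (hvD s (Ico_subset_Icc_self hs))
      rw [norm_mul, hexp]
      have h7 : Real.exp (a * s) ≤ Real.exp (a * t) := by
        have := hs.2.le
        gcongr
      calc Real.exp (a * s) * ‖f (v s) + a * v s‖
          ≤ Real.exp (a * t) * (η * ((1 + κ) * ε)) := by gcongr; exact h6.trans (by gcongr)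
        _ = κ * ε / (t + 1) / 2 := by rw [hη]; field_simp
        _ < κ * ε / (t + 1) := half_lt_self (by positivity)
  have hlim : ‖Complex.exp (a * s) * v s - v 0‖ ≤ κ * ‖v 0‖ := by
    have hcont : Continuous fun ε : ℝ => κ * ε := by fun_prop
    refine ge_of_tendsto ((hcont.tendsto ‖v 0‖).mono_left (nhdsWithin_le_nhds (s := Ioi ‖v 0‖))) ?_
    filter_upwards [Ioo_mem_nhdsGT hv0] with ε hε using hmain ε hε.1 hε.2
  have hfac : v s - Complex.exp (-a * s) * v 0
      = Complex.exp (-a * s) * (Complex.exp (a * s) * v s - v 0) := by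
    rw [mul_sub, ← mul_assoc, ← Complex.exp_add]
    simp
  have hle : ‖Complex.exp (-a * s)‖ ≤ 1 := by
    rw [Complex.norm_exp, Real.exp_le_one_iff]
    have := mul_nonneg ha hs.1
    simpa using this
  rw [hfac, norm_mul]
  exact (mul_le_of_le_one_left (norm_nonneg _) hle).trans hlim

theorem intervalIntegral_exp_neg_mul {a : ℝ} (ha : a ≠ 0) (t : ℝ) :
    ∫ s in (0 : ℝ)..t, Complex.exp (-a * s) = (1 - Complex.exp (-a * t)) / a := by
  have ha' : (a : ℂ) ≠ 0 := Complex.ofReal_ne_zero.2 ha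
  rw [integral_exp_mul_complex (neg_ne_zero.2 ha')]
  simp only [Complex.ofReal_zero, mul_zero, Complex.exp_zero]
  field_simp
  ring

/-- The integral of `g` along solutions of `v' = f v`, where `g v = c v + o(v)` at `0`, is
asymptotic to the integral of the linearization for small initial values. -/
theorem exists_norm_integral_sub_le_of_isLittleO {f g : ℂ → ℂ} {D : Set ℂ} {a c t κ : ℝ}
    (ha : 0 < a) (ht : 0 ≤ t) (hκ : 0 < κ)
    (hf : (fun v => f v + a * v) =o[𝓝[D] 0] fun v => v)
    (hg : (fun v => g v - c * v) =o[𝓝[D] 0] fun v => v) (hgc : ContinuousOn g D) :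
    ∃ δ > 0, ∀ v : ℝ → ℂ, (∀ s ∈ Icc 0 t, v s ∈ D) →
      (∀ s ∈ Icc 0 t, HasDerivAt v (f (v s)) s) → ‖v 0‖ < δ →
      ‖(∫ s in (0 : ℝ)..t, g (v s)) - c / a * (1 - Complex.exp (-a * t)) * v 0‖
        ≤ κ * ‖v 0‖ := by
  set κ' : ℝ := κ / (2 * (t + 1)) with hκ'
  have hκ'0 : 0 < κ' := by positivity
  set κ₁ : ℝ := κ' / (|c| + 1) with hκ₁
  have hκ₁0 : 0 < κ₁ := by positivity
  obtain ⟨δ, hδ, hv⟩ := exists_norm_sub_exp_mul_le_of_isLittleO ha.le ht hκ₁0 hf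
  obtain ⟨r, hr, hgr⟩ := Metric.eventually_nhds_iff.1
    (eventually_nhdsWithin_iff.1 (hg.bound (c := κ' / (1 + κ₁)) (by positivity)))
  refine ⟨min δ (r / (1 + κ₁)), by positivity, fun v hvD hvd hv0 => ?_⟩
  have hclose := hv v hvD hvd (hv0.trans_le (min_le_left _ _))
  have hcont : ContinuousOn (fun s => g (v s)) (uIcc 0 t) := by
    rw [uIcc_of_le ht]
    exact hgc.comp (fun s hs => (hvd s hs).continuousAt.continuousWithinAt) hvD
  have hlin : ∫ s in (0 : ℝ)..t, (c : ℂ) * Complex.exp (-a * s) * v 0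
      = c / a * (1 - Complex.exp (-a * t)) * v 0 := by
    rw [intervalIntegral.integral_mul_const, intervalIntegral.integral_const_mul,
      intervalIntegral_exp_neg_mul ha.ne']
    ring
  rw [← hlin, ← intervalIntegral.integral_sub hcont.intervalIntegrable
    (Continuous.intervalIntegrable (by fun_prop) _ _)]
  have hpt : ∀ s ∈ Set.uIoc 0 t, ‖g (v s) - (c : ℂ) * Complex.exp (-a * s) * v 0‖
      ≤ 2 * κ' * ‖v 0‖ := by
    intro s hs
    rw [uIoc_of_le ht] at hs
    have hs' : s ∈ Icc 0 t := Ioc_subset_Icc_self hs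
    have h1 := hclose s hs'
    have hle : ‖Complex.exp (-a * s)‖ ≤ 1 := by
      rw [Complex.norm_exp, Real.exp_le_one_iff]
      have := mul_nonneg ha.le hs'.1
      simpa using this
    have h2 : ‖v s‖ ≤ (1 + κ₁) * ‖v 0‖ := by
      have h3 := norm_add_le (v s - Complex.exp (-a * s) * v 0) (Complex.exp (-a * s) * v 0)
      rw [sub_add_cancel, norm_mul (Complex.exp _)] at h3
      have := mul_le_of_le_one_left (norm_nonneg (v 0)) hle
      linarith
    have h4 : ‖v s‖ < r := by
      have h5 := hv0.trans_le (min_le_right _ _)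
      rw [lt_div_iff₀ (by positivity)] at h5
      linarith
    have h6 := hgr (by simpa using h4) (hvD s hs')
    have h7 : ‖g (v s) - c * v s‖ ≤ κ' * ‖v 0‖ := by
      calc _ ≤ κ' / (1 + κ₁) * ‖v s‖ := h6
        _ ≤ κ' / (1 + κ₁) * ((1 + κ₁) * ‖v 0‖) := by gcongr
        _ = κ' * ‖v 0‖ := by field_simp
    have h8 : ‖(c : ℂ) * (v s - Complex.exp (-a * s) * v 0)‖ ≤ κ' * ‖v 0‖ := by
      rw [norm_mul, Complex.norm_real, Real.norm_eq_abs]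
      calc |c| * ‖v s - Complex.exp (-a * s) * v 0‖ ≤ (|c| + 1) * (κ₁ * ‖v 0‖) := by
            gcongr
            linarith
        _ = κ' * ‖v 0‖ := by rw [hκ₁]; field_simp
    have h9 : g (v s) - (c : ℂ) * Complex.exp (-a * s) * v 0
        = (g (v s) - c * v s) + (c : ℂ) * (v s - Complex.exp (-a * s) * v 0) := by ring
    rw [h9]
    exact (norm_add_le _ _).trans (by linarith)
  refine (intervalIntegral.norm_integral_le_of_norm_le_const hpt).trans ?_
  rw [sub_zero, abs_of_nonneg ht]
  have h10 : 2 * κ' * (t + 1) = κ := by rw [hκ']; field_simp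
  nlinarith [norm_nonneg (v 0), mul_nonneg hκ'0.le (norm_nonneg (v 0))]

theorem hasDerivAt_zero_of_forall_norm_sub_le {F : ℝ → ℂ} {c : ℂ}
    (h : ∀ κ > 0, ∃ δ > 0, ∀ θ : ℝ, |θ| < δ → ‖F θ - θ * c‖ ≤ κ * |θ|) :
    HasDerivAt F c 0 := by
  have h0 : F 0 = 0 := by
    obtain ⟨δ, hδ, hF⟩ := h 1 one_pos
    simpa using hF 0 (by simpa using hδ)
  rw [hasDerivAt_iff_isLittleO]
  refine Asymptotics.isLittleO_iff.2 fun κ hκ => ?_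
  obtain ⟨δ, hδ, hF⟩ := h κ hκ
  filter_upwards [Metric.ball_mem_nhds (0 : ℝ) hδ] with θ hθ
  simpa [h0] using hF θ (by simpa using hθ)

namespace AffineSemigroup

variable (S : AffineSemigroup)

theorem ae_m_fst_nonneg : ∀ᵐ z ∂S.m, 0 ≤ z.1 :=
  measure_mono_null (fun _ hz => Or.inl (by simpa using hz)) S.m_supp

theorem ae_n_fst_nonneg : ∀ᵐ z ∂S.n, 0 ≤ z.1 :=
  measure_mono_null (fun _ hz => Or.inl (by simpa using hz)) S.n_supp

theorem integrable_m_min : Integrable (fun z : ℝ × ℝ => min z.1 (z.1 ^ 2)) S.m := by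
  refine (lintegral_ofReal_ne_top_iff_integrable
    (Measurable.aestronglyMeasurable (by fun_prop)) ?_).1 (ne_top_of_le_ne_top S.m_int.ne
      (lintegral_mono fun z => ENNReal.ofReal_le_ofReal (by nlinarith [sq_nonneg z.2])))
  filter_upwards [S.ae_m_fst_nonneg] with z hz using le_min hz (sq_nonneg _)

theorem integrable_n_fst (hγ : ∫⁻ z : ℝ × ℝ, ENNReal.ofReal z.1 ∂S.n < ⊤) :
    Integrable (fun z : ℝ × ℝ => z.1) S.n :=
  (lintegral_ofReal_ne_top_iff_integrable measurable_fst.aestronglyMeasurable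
    S.ae_n_fst_nonneg).1 hγ.ne

theorem isLittleO_phi :
    (fun v => phi S.a₁ S.b₁ S.α₁₁ S.α₁₂ S.α₂₁ S.α₂₂ S.m (v, 0) + S.a₁ * v)
      =o[𝓝[{v : ℂ | v.re ≤ 0}] 0] fun v => v := by
  have h1 := isLittleO_integral_exp_sub_one_sub_id measurable_fst S.ae_m_fst_nonneg
    S.integrable_m_min
  have h2 : (fun v : ℂ => ((S.α₁₁ : ℂ) + S.α₁₂) * v ^ 2)
      =o[𝓝[{v : ℂ | v.re ≤ 0}] 0] fun v => v := by
    refine Asymptotics.IsLittleO.const_mul_left ?_ _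
    simpa using (Asymptotics.isLittleO_pow_pow (𝕜 := ℂ) (m := 1) (n := 2) one_lt_two).mono
      nhdsWithin_le_nhds
  refine (h1.add h2).congr_left fun v => ?_
  simp only [phi, mul_zero, zero_mul, add_zero, sub_zero]
  ring

theorem psi_zero_eq (v : ℂ) :
    psi S.a₂ S.b₀ S.σ S.n (v, 0) = S.a₂ * v + ∫ z : ℝ × ℝ, (Complex.exp (v * z.1) - 1) ∂S.n := by
  simp [psi]

theorem isLittleO_psi (hn : Integrable (fun z : ℝ × ℝ => z.1) S.n) :
    (fun v => psi S.a₂ S.b₀ S.σ S.n (v, 0) - (S.a₂ + ∫ z : ℝ × ℝ, z.1 ∂S.n : ℝ) * v)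
      =o[𝓝[{v : ℂ | v.re ≤ 0}] 0] fun v => v := by
  have hmin : Integrable (fun z : ℝ × ℝ => min z.1 (z.1 ^ 2)) S.n := by
    refine hn.mono (Measurable.aestronglyMeasurable (by fun_prop)) ?_
    filter_upwards [S.ae_n_fst_nonneg] with z hz
    rw [Real.norm_of_nonneg (le_min hz (sq_nonneg _)), Real.norm_of_nonneg hz]
    exact min_le_left _ _
  refine (isLittleO_integral_exp_sub_one_sub_id measurable_fst S.ae_n_fst_nonneg
    hmin).congr' ?_ Filter.EventuallyEq.rfl
  filter_upwards [self_mem_nhdsWithin] with v hv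
  have hlin : Integrable (fun z : ℝ × ℝ => v * (z.1 : ℂ)) S.n := hn.ofReal.const_mul v
  have hexp : Integrable (fun z : ℝ × ℝ => Complex.exp (v * z.1) - 1) S.n := by
    refine (hlin.norm.const_mul 4).mono' (Measurable.aestronglyMeasurable (by fun_prop)) ?_
    filter_upwards [S.ae_n_fst_nonneg] with z hz
    exact norm_exp_sub_one_le_of_re_nonpos (mul_ofReal_re_nonpos hv hz)
  rw [integral_sub hexp hlin, psi_zero_eq, integral_const_mul, integral_complex_ofReal]
  push_cast
  ring

theorem continuousOn_psi (hn : Integrable (fun z : ℝ × ℝ => z.1) S.n) :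
    ContinuousOn (fun v => psi S.a₂ S.b₀ S.σ S.n (v, 0)) {v : ℂ | v.re ≤ 0} := by
  simp_rw [psi_zero_eq]
  refine ContinuousOn.add (by fun_prop) fun v₀ hv₀ => ?_
  refine continuousWithinAt_of_dominated
    (bound := fun z : ℝ × ℝ => 4 * ((‖v₀‖ + 1) * ‖z.1‖))
    (Eventually.of_forall fun v => Measurable.aestronglyMeasurable (by fun_prop)) ?_
    ((hn.norm.const_mul _).const_mul _)
    (Eventually.of_forall fun z => Continuous.continuousWithinAt (by fun_prop))
  have hnear : ∀ᶠ v : ℂ in 𝓝[{v : ℂ | v.re ≤ 0}] v₀, ‖v‖ < ‖v₀‖ + 1 :=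
    nhdsWithin_le_nhds (continuous_norm.continuousAt.eventually (gt_mem_nhds (lt_add_one _)))
  filter_upwards [hnear, self_mem_nhdsWithin] with v hv hre
  filter_upwards [S.ae_n_fst_nonneg] with z hz
  refine (norm_exp_sub_one_le_of_re_nonpos (mul_ofReal_re_nonpos hre hz)).trans ?_
  rw [norm_mul, Complex.norm_real]
  gcongr

/-- The characteristic exponent of the first coordinate is differentiable at the origin. -/
theorem hasDerivAt_exponent (ha₁ : 0 < S.a₁) (hn : Integrable (fun z : ℝ × ℝ => z.1) S.n)
    {t : ℝ} (ht : 0 ≤ t) (x : ℝ) :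
    HasDerivAt (fun θ : ℝ => x * S.V₁ t (θ * Complex.I, 0)
        + ∫ s in (0 : ℝ)..t, psi S.a₂ S.b₀ S.σ S.n (S.V₁ s (θ * Complex.I, 0), 0))
      ((x * Real.exp (-S.a₁ * t)
          + ((S.a₂ + ∫ z : ℝ × ℝ, z.1 ∂S.n) / S.a₁) * (1 - Real.exp (-S.a₁ * t)) : ℝ)
        * Complex.I) 0 := by
  have hre : ∀ θ : ℝ, ((θ : ℂ) * Complex.I).re ≤ 0 := fun θ => by simp
  have hmem : ∀ θ : ℝ, ∀ s ∈ Icc 0 t, S.V₁ s (θ * Complex.I, 0) ∈ {v : ℂ | v.re ≤ 0} :=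
    fun θ s hs => S.V₁_mem _ (hre θ) rfl s hs.1
  have hode : ∀ θ : ℝ, ∀ s ∈ Icc 0 t, HasDerivAt (fun s => S.V₁ s (θ * Complex.I, 0))
      (phi S.a₁ S.b₁ S.α₁₁ S.α₁₂ S.α₂₁ S.α₂₂ S.m (S.V₁ s (θ * Complex.I, 0), 0)) s :=
    fun θ s hs => by simpa using S.V₁_ode (θ * Complex.I, 0) (hre θ) rfl s hs.1
  have hV : HasDerivAt (fun θ : ℝ => S.V₁ t (θ * Complex.I, 0))
      (Complex.exp (-S.a₁ * t) * Complex.I) 0 := by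
    refine hasDerivAt_zero_of_forall_norm_sub_le fun κ hκ => ?_
    obtain ⟨δ, hδ, h⟩ := exists_norm_sub_exp_mul_le_of_isLittleO ha₁.le ht hκ S.isLittleO_phi
    refine ⟨δ, hδ, fun θ hθ => ?_⟩
    have := h _ (hmem θ) (hode θ) (by simpa [S.V₁_init] using hθ) t (right_mem_Icc.2 ht)
    simp only [S.V₁_init, norm_mul, Complex.norm_I, mul_one, Complex.norm_real,
      Real.norm_eq_abs] at this
    convert this using 2
    ring
  have hI : HasDerivAt (fun θ : ℝ => ∫ s in (0 : ℝ)..t,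
        psi S.a₂ S.b₀ S.σ S.n (S.V₁ s (θ * Complex.I, 0), 0))
      ((S.a₂ + ∫ z : ℝ × ℝ, z.1 ∂S.n : ℝ) / S.a₁ * (1 - Complex.exp (-S.a₁ * t))
        * Complex.I) 0 := by
    refine hasDerivAt_zero_of_forall_norm_sub_le fun κ hκ => ?_
    obtain ⟨δ, hδ, h⟩ := exists_norm_integral_sub_le_of_isLittleO ha₁ ht hκ S.isLittleO_phi
      (S.isLittleO_psi hn) (S.continuousOn_psi hn)
    refine ⟨δ, hδ, fun θ hθ => ?_⟩
    have := h _ (hmem θ) (hode θ) (by simpa [S.V₁_init] using hθ)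
    simp only [S.V₁_init, norm_mul, Complex.norm_I, mul_one, Complex.norm_real,
      Real.norm_eq_abs] at this
    convert this using 2
    ring
  refine ((hV.const_mul (x : ℂ)).add hI).congr_deriv ?_
  push_cast
  ring

theorem hasDerivAt_integral_exp (ha₁ : 0 < S.a₁)
    (hn : Integrable (fun z : ℝ × ℝ => z.1) S.n)
    {t : ℝ} (ht : 0 ≤ t) {x : ℝ × ℝ} (hx : 0 ≤ x.1) :
    HasDerivAt (fun θ : ℝ => ∫ ξ : ℝ × ℝ, Complex.exp (θ * Complex.I * ξ.1) ∂(S.P t x))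
      ((x.1 * Real.exp (-S.a₁ * t)
          + ((S.a₂ + ∫ z : ℝ × ℝ, z.1 ∂S.n) / S.a₁) * (1 - Real.exp (-S.a₁ * t)) : ℝ)
        * Complex.I) 0 := by
  have hchar : ∀ θ : ℝ, ∫ ξ : ℝ × ℝ, Complex.exp (θ * Complex.I * ξ.1) ∂(S.P t x)
      = Complex.exp (x.1 * S.V₁ t (θ * Complex.I, 0)
        + ∫ s in (0 : ℝ)..t, psi S.a₂ S.b₀ S.σ S.n (S.V₁ s (θ * Complex.I, 0), 0)) := fun θ => by
    simpa using S.P_char t ht x hx (θ * Complex.I, 0) (by simp) rfl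
  have := S.P_prob t ht x hx
  have hone := hchar 0
  simp only [Complex.ofReal_zero, zero_mul, Complex.exp_zero, integral_const, probReal_univ,
    one_smul] at hone
  simp_rw [hchar]
  refine (S.hasDerivAt_exponent ha₁ hn ht x.1).cexp.congr_deriv ?_
  rw [Complex.ofReal_zero, zero_mul, ← hone, one_mul]

end AffineSemigroup

/-- First moment formula for the first coordinate of the affine semigroup. -/
theorem first_coordinate_moment_formula
    (S : AffineSemigroup) (ha₁ : 0 < S.a₁)
    (hγ : ∫⁻ z : ℝ × ℝ, ENNReal.ofReal z.1 ∂S.n < ⊤) :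
    (∀ t ≥ (0:ℝ), ∀ x : ℝ × ℝ, 0 ≤ x.1 →
      Integrable (fun ξ : ℝ × ℝ => ξ.1) (S.P t x) ∧
      ∫ ξ : ℝ × ℝ, ξ.1 ∂(S.P t x)
        = x.1 * Real.exp (-S.a₁ * t)
          + ((S.a₂ + ∫ z : ℝ × ℝ, z.1 ∂S.n) / S.a₁) * (1 - Real.exp (-S.a₁ * t))) ∧
    ∀ t ≥ (0:ℝ), ∀ x y : ℝ × ℝ, 0 ≤ x.1 → 0 ≤ y.1 →
      (∫ ξ : ℝ × ℝ, ξ.1 ∂(S.P t x)) - ∫ ξ : ℝ × ℝ, ξ.1 ∂(S.P t y)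
        = (x.1 - y.1) * Real.exp (-S.a₁ * t) := by
  have key : ∀ t ≥ (0:ℝ), ∀ x : ℝ × ℝ, 0 ≤ x.1 →
      Integrable (fun ξ : ℝ × ℝ => ξ.1) (S.P t x) ∧
      ∫ ξ : ℝ × ℝ, ξ.1 ∂(S.P t x)
        = x.1 * Real.exp (-S.a₁ * t)
          + ((S.a₂ + ∫ z : ℝ × ℝ, z.1 ∂S.n) / S.a₁) * (1 - Real.exp (-S.a₁ * t)) := by
    intro t ht x hx
    have := S.P_prob t ht x hx
    have hnonneg : ∀ᵐ ξ ∂(S.P t x), 0 ≤ ξ.1 :=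
      measure_mono_null (fun _ hξ => by simpa using hξ) (S.P_supp t ht x hx)
    exact integrable_and_integral_eq_of_hasDerivAt_integral_exp measurable_fst hnonneg
      (S.hasDerivAt_integral_exp ha₁ (S.integrable_n_fst hγ) ht hx)
  refine ⟨key, fun t ht x y hx hy => ?_⟩
  rw [(key t ht x hx).2, (key t ht y hy).2]
  ring

end AffinePaper
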